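/- A hypersemigroup (H, ∘) is both regular and intra-regular if and only if for every right ideal X of H, every left ideal Y of H, and every bi-ideal B of H, X ∩ B ∩ Y ⊆ (B*X)*Y. -/

import Mathlib

/-- The product of subsets of a hypergroupoid: `A*B := ⋃_{(a,b) ∈ A×B} a∘b`. -/
def hProd {H : Type*} (circ : H → H → Set H) (A B : Set H) : Set H :=
  ⋃ a ∈ A, ⋃ b ∈ B, circ a b

section HProd

variable {H : Type*} {circ : H → H → Set H}

theorem mem_hProd {A B : Set H} {c : H} :
    c ∈ hProd circ A B ↔ ∃ a ∈ A, ∃ b ∈ B, c ∈ circ a b := by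
  simp [hProd]

theorem hProd_singleton (a b : H) : hProd circ {a} {b} = circ a b := by
  simp [hProd]

theorem hProd_mono {A B C D : Set H} (h : A ⊆ C) (h' : B ⊆ D) :
    hProd circ A B ⊆ hProd circ C D := by
  intro c hc
  obtain ⟨a, ha, b, hb, hc⟩ := mem_hProd.1 hc
  exact mem_hProd.2 ⟨a, h ha, b, h' hb, hc⟩

theorem union_hProd (A B C : Set H) :
    hProd circ (A ∪ B) C = hProd circ A C ∪ hProd circ B C := by
  simp only [hProd, Set.biUnion_union]

theorem hProd_union (A B C : Set H) :
    hProd circ A (B ∪ C) = hProd circ A B ∪ hProd circ A C := by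
  simp only [hProd, Set.biUnion_union, Set.iUnion_union_distrib]

theorem hProd_assoc
    (assoc : ∀ x y z : H, hProd circ {x} (circ y z) = hProd circ (circ x y) {z})
    (A B C : Set H) :
    hProd circ (hProd circ A B) C = hProd circ A (hProd circ B C) := by
  ext d
  constructor
  · intro hd
    obtain ⟨e, he, c, hc, hd⟩ := mem_hProd.1 hd
    obtain ⟨a, ha, b, hb, he⟩ := mem_hProd.1 he
    have key : d ∈ hProd circ {a} (circ b c) :=
      assoc a b c ▸ mem_hProd.2 ⟨e, he, c, rfl, hd⟩
    refine hProd_mono (by simpa using ha) (fun f hf => ?_) key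
    exact mem_hProd.2 ⟨b, hb, c, hc, hf⟩
  · intro hd
    obtain ⟨a, ha, e, he, hd⟩ := mem_hProd.1 hd
    obtain ⟨b, hb, c, hc, he⟩ := mem_hProd.1 he
    have key : d ∈ hProd circ (circ a b) {c} :=
      assoc a b c ▸ mem_hProd.2 ⟨a, rfl, e, he, hd⟩
    refine hProd_mono (fun f hf => ?_) (by simpa using hc) key
    exact mem_hProd.2 ⟨a, ha, b, hb, hf⟩

end HProd

/-- Proposition 25: a hypersemigroup is both regular and intra-regular iff
`X ∩ B ∩ Y ⊆ (B*X)*Y` for every right ideal `X`, every left ideal `Y` and every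
bi-ideal `B`. -/
theorem regular_and_intraRegular_iff_biIdeal {H : Type*} [Nonempty H]
    (circ : H → H → Set H) (hcirc : ∀ a b : H, (circ a b).Nonempty)
    (assoc : ∀ x y z : H, hProd circ {x} (circ y z) = hProd circ (circ x y) {z}) :
    ((∀ a : H, ∃ x : H, a ∈ hProd circ (circ a x) {a}) ∧
      (∀ a : H, ∃ x y : H,
        a ∈ hProd circ (hProd circ (hProd circ {x} {a}) {a}) {y})) ↔
      (∀ X Y B : Set H, X.Nonempty → Y.Nonempty → B.Nonempty →
        hProd circ X Set.univ ⊆ X → hProd circ Set.univ Y ⊆ Y →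
        hProd circ (hProd circ B Set.univ) B ⊆ B →
        X ∩ B ∩ Y ⊆ hProd circ (hProd circ B X) Y) := by
  have as := hProd_assoc assoc
  have mono {A B C D : Set H} (h : A ⊆ C) (h' : B ⊆ D) :
      hProd circ A B ⊆ hProd circ C D := hProd_mono h h'
  constructor
  · rintro ⟨hreg, hintra⟩ X Y B - - - hX hY hB a ⟨⟨haX, haB⟩, haY⟩
    obtain ⟨x, hx⟩ := hreg a
    obtain ⟨y, z, hyz⟩ := hintra a
    have haX' : {a} ⊆ X := Set.singleton_subset_iff.2 haX
    have haB' : {a} ⊆ B := Set.singleton_subset_iff.2 haB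
    have haY' : {a} ⊆ Y := Set.singleton_subset_iff.2 haY
    rw [← hProd_singleton (circ := circ) a x] at hx
    have hx' := mono (mono (C := {a}) (D := {x}) subset_rfl subset_rfl)
      (Set.singleton_subset_iff.2 hx) hx
    have hxyz : a ∈ hProd circ (hProd circ (hProd circ (hProd circ {a} (hProd circ {x} {y})) {a})
        (hProd circ {a} (hProd circ {z} {x}))) {a} := by
      have := mono (mono (C := {a}) (D := {x}) subset_rfl subset_rfl)
        (mono (mono (Set.singleton_subset_iff.2 hyz) (D := {x}) subset_rfl)
          (D := {a}) subset_rfl) (by simpa only [as] using hx')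
      simpa only [as] using this
    refine mono (mono ?_ ?_) haY' hxyz
    · exact (mono (mono haB' (Set.subset_univ _)) haB').trans hB
    · exact (mono haX' (Set.subset_univ _)).trans hX
  · intro h
    have hU (A : Set H) : A ⊆ Set.univ := Set.subset_univ A
    have hR (a : H) : hProd circ ({a} ∪ hProd circ {a} Set.univ) Set.univ ⊆
        hProd circ {a} Set.univ := by
      rw [union_hProd, as]
      exact Set.union_subset subset_rfl (mono subset_rfl (hU _))
    have hL (a : H) : hProd circ Set.univ ({a} ∪ hProd circ Set.univ {a}) ⊆
        hProd circ Set.univ {a} := by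
      rw [hProd_union, ← as]
      exact Set.union_subset subset_rfl (mono (hU _) subset_rfl)
    have haR (a : H) : a ∈ {a} ∪ hProd circ {a} Set.univ := Or.inl rfl
    have haL (a : H) : a ∈ {a} ∪ hProd circ Set.univ {a} := Or.inl rfl
    have hR' (a : H) := (hR a).trans (Set.subset_union_right (s := {a}))
    have hL' (a : H) := (hL a).trans (Set.subset_union_right (s := {a}))
    refine ⟨fun a => ?_, fun a => ?_⟩
    · have key := h Set.univ _ _ ⟨a, hU _ rfl⟩ ⟨a, haL a⟩ ⟨a, haR a⟩ (hU _) (hL' a)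
        ((mono (hR' a) (hU _)).trans (hR' a)) ⟨⟨hU _ rfl, haR a⟩, haL a⟩
      have key := mono (hR a) subset_rfl key
      rw [as] at key
      have key := mono subset_rfl (hL a) key
      rw [← as] at key
      obtain ⟨u, hu, c, rfl, hc⟩ := mem_hProd.1 key
      obtain ⟨b, rfl, x, -, hx⟩ := mem_hProd.1 hu
      exact ⟨x, mem_hProd.2 ⟨u, hx, _, rfl, hc⟩⟩
    · have key := h _ Set.univ _ ⟨a, haR a⟩ ⟨a, hU _ rfl⟩ ⟨a, haL a⟩ (hR' a) (hU _)
        (by rw [as]; exact (mono (hU _) (hL' a)).trans (hL' a)) ⟨⟨haR a, haL a⟩, hU _ rfl⟩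
      rw [as] at key
      have key := mono subset_rfl (hR a) key
      rw [union_hProd] at key
      have key : a ∈ hProd circ (hProd circ Set.univ {a}) (hProd circ {a} Set.univ) := by
        rcases key with key | key
        · have := mono subset_rfl
            (mono (Set.singleton_subset_iff.2 key) (D := Set.univ) subset_rfl) key
          have := mono (hU {a}) (D := hProd circ {a} (hProd circ {a} Set.univ)) (by
            rw [as, as]
            exact mono subset_rfl (mono subset_rfl (hU _))) this
          rwa [as]
        · exact key
      rw [← as] at key
      obtain ⟨u, hu, y, -, hy⟩ := mem_hProd.1 key
      obtain ⟨v, hv, b, hb, hu⟩ := mem_hProd.1 hu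
      obtain ⟨x, -, c, hc, hv⟩ := mem_hProd.1 hv
      exact ⟨x, y, mem_hProd.2 ⟨u, mem_hProd.2 ⟨v, mem_hProd.2 ⟨x, rfl, c, hc, hv⟩, b, hb, hu⟩,
        y, rfl, hy⟩⟩
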